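/- Let p, q be integers with q ≥ p ≥ 2, fix k ∈ {1,…,p−1}, and let g : ℝ^p → ℝ be bounded and measurable on the simplex Δ_p = {u ∈ ℝ^p : 0 ≤ u₁ ≤ ⋯ ≤ u_p ≤ 1}. For real λ with |λ − (−p+k)| ≤ 1/2 and (u₁,…,u_{p−k}) ∈ Δ_{p−k} = {0 ≤ u₁ ≤ ⋯ ≤ u_{p−k} ≤ 1}, define F(λ, u₁,…,u_{p−k}) = ∫_{u_{p−k} ≤ u_{p−k+1} ≤ ⋯ ≤ u_p ≤ 1} [∏_{i=p−k+1}^p u_i^{(λ−1)/2}] · [∏_{1 ≤ i ≤ p−k < j ≤ p} (u_j − u_i)] · [∏_{p−k < i < j ≤ p} (u_j − u_i)] · [∏_{i=p−k+1}^p (1−u_i)^{(q−p−1)/2}] · g(u₁,…,u_p) du_{p−k+1} ⋯ du_p. Then all these integrals are finite, and F(λ,·) converges to F(−p+k,·) uniformly on Δ_{p−k} as λ → −p+k. -/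

import Mathlib

open MeasureTheory Filter Set

/-- Concatenate a vector of length `p - k` with a vector of length `k` into a vector of
length `p`. -/
def splice {p k : ℕ} (hk : k ≤ p) (w : Fin (p - k) → ℝ) (v : Fin k → ℝ) (i : Fin p) : ℝ :=
  if h : (i : ℕ) < p - k then w ⟨i, h⟩ else v ⟨(i : ℕ) - (p - k), by have := i.isLt; omega⟩

/-- The simplex `0 ≤ u₁ ≤ ⋯ ≤ u_m ≤ 1`. -/
def simplex (m : ℕ) : Set (Fin m → ℝ) := {u | Monotone u ∧ ∀ i, 0 ≤ u i ∧ u i ≤ 1}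

/-- Region of integration for the inner `k`-fold integral: `u_{p-k} ≤ u_{p-k+1} ≤ ⋯ ≤ u_p ≤ 1`
(in the variables `v = (u_{p-k+1}, …, u_p)`, with `w = (u₁, …, u_{p-k})`). -/
def region16 (p k : ℕ) (w : Fin (p - k) → ℝ) : Set (Fin k → ℝ) :=
  {v | Monotone v ∧ (∀ j, v j ≤ 1) ∧ ∀ i : Fin (p - k), ∀ j : Fin k, w i ≤ v j}

/-- Integrand of the inner `k`-fold integral of the cosine-λ transform on the real
Grassmannian (d = 1), as a function of `v = (u_{p-k+1}, …, u_p)`. -/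
noncomputable def integrand16 (p q k : ℕ) (hk : k ≤ p) (g : (Fin p → ℝ) → ℝ) (l : ℝ)
    (w : Fin (p - k) → ℝ) (v : Fin k → ℝ) : ℝ :=
  (∏ j : Fin k, v j ^ ((l - 1) / 2)) *
    ((∏ i : Fin (p - k), ∏ j : Fin k, (v j - w i)) *
      ((∏ j : Fin k, ∏ i : Fin k, if i < j then v j - v i else 1) *
        ((∏ j : Fin k, (1 - v j) ^ (((q : ℝ) - (p : ℝ) - 1) / 2)) * g (splice hk w v))))

/-- The weight `∏ j, v j ^ s * (1 - v j) ^ (-1/2)` on the open unit cube, extended by zero. -/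
noncomputable def cubeWeight (k : ℕ) (s : ℝ) (v : Fin k → ℝ) : ℝ :=
  ∏ j, (Ioo (0 : ℝ) 1).indicator (fun t => t ^ s * (1 - t) ^ (-(1 / 2) : ℝ)) (v j)

lemma cubeWeight_eq_of_mem {k : ℕ} (s : ℝ) {v : Fin k → ℝ} (hv : ∀ j, v j ∈ Ioo (0 : ℝ) 1) :
    cubeWeight k s v = (∏ j, v j ^ s) * ∏ j, (1 - v j) ^ (-(1 / 2) : ℝ) := by
  simp only [cubeWeight, ← Finset.prod_mul_distrib]
  exact Finset.prod_congr rfl fun j _ => indicator_of_mem (hv j) _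

lemma cubeWeight_nonneg {k : ℕ} (s : ℝ) (v : Fin k → ℝ) : 0 ≤ cubeWeight k s v :=
  Finset.prod_nonneg fun _ _ => indicator_nonneg (fun _ ht =>
    mul_nonneg (Real.rpow_nonneg ht.1.le _) (Real.rpow_nonneg (sub_nonneg.2 ht.2.le) _)) _

lemma cubeWeight_anti {k : ℕ} {s t : ℝ} (hst : s ≤ t) (v : Fin k → ℝ) :
    cubeWeight k t v ≤ cubeWeight k s v := by
  refine Finset.prod_le_prod (fun j _ => indicator_nonneg (fun x hx =>
    mul_nonneg (Real.rpow_nonneg hx.1.le _) (Real.rpow_nonneg (sub_nonneg.2 hx.2.le) _)) _)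
    fun _ _ => indicator_le_indicator' fun hx => ?_
  exact mul_le_mul_of_nonneg_right (Real.rpow_le_rpow_of_exponent_ge hx.1 hx.2.le hst)
    (Real.rpow_nonneg (sub_nonneg.2 hx.2.le) _)

lemma integrable_cubeWeight (k : ℕ) {s : ℝ} (hs : -1 < s) :
    Integrable (cubeWeight k s) := by
  have h := Complex.betaIntegral_convergent (u := ((s + 1 : ℝ) : ℂ)) (v := ((1 / 2 : ℝ) : ℂ))
    (by simpa using by linarith) (by simp)
  rw [intervalIntegrable_iff_integrableOn_Ioo_of_le zero_le_one] at h
  have h1 : IntegrableOn (fun t : ℝ => t ^ s * (1 - t) ^ (-(1 / 2) : ℝ)) (Ioo 0 1) := by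
    refine h.norm.congr ((ae_restrict_mem measurableSet_Ioo).mono fun t ht => ?_)
    have ht' : (1 - (t : ℂ)) = ((1 - t : ℝ) : ℂ) := by push_cast; ring
    simp only [norm_mul]
    rw [ht', Complex.norm_cpow_eq_rpow_re_of_pos ht.1,
      Complex.norm_cpow_eq_rpow_re_of_pos (sub_pos.2 ht.2)]
    norm_num
  rw [← integrable_indicator_iff measurableSet_Ioo] at h1
  exact Integrable.fintype_prod (f := fun _ => (Ioo (0 : ℝ) 1).indicator _) fun _ => h1

lemma tendsto_cubeWeight {k : ℕ} (v : Fin k → ℝ) :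
    Tendsto (fun s => cubeWeight k s v) (nhds 0) (nhds (cubeWeight k 0 v)) := by
  refine tendsto_finsetProd _ fun j _ => ?_
  by_cases hj : v j ∈ Ioo (0 : ℝ) 1
  · simp only [indicator_of_mem hj]
    exact ((Real.continuousAt_const_rpow hj.1.ne').tendsto).mul_const _
  · simp only [indicator_of_notMem hj]
    exact tendsto_const_nhds

/-- `L¹`-continuity of the weight at the exponent zero. -/
lemma tendsto_integral_abs_cubeWeight_sub (k : ℕ) :
    Tendsto (fun s => ∫ v, |cubeWeight k s v - cubeWeight k 0 v|) (nhds 0) (nhds 0) := by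
  have h : Tendsto (fun s => ∫ v, |cubeWeight k s v - cubeWeight k 0 v|) (nhds 0)
      (nhds (∫ _ : Fin k → ℝ, (0 : ℝ))) := by
    have hmem : ∀ᶠ s : ℝ in nhds 0, s ∈ Ioi (-(1 / 4) : ℝ) :=
      Ioi_mem_nhds (by norm_num)
    refine tendsto_integral_filter_of_dominated_convergence
      (cubeWeight k (-(1 / 4))) ?_ ?_ (integrable_cubeWeight k (by norm_num)) ?_
    · filter_upwards [hmem] with s hs
      have hs' : -(1 / 4) < s := hs
      exact ((integrable_cubeWeight k (by linarith)).sub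
        (integrable_cubeWeight k (by norm_num))).abs.aestronglyMeasurable
    · filter_upwards [hmem] with s hs
      have hs' : -(1 / 4) < s := hs
      refine Eventually.of_forall fun v => ?_
      rw [Real.norm_eq_abs, abs_abs, abs_le]
      have h1 := cubeWeight_anti hs'.le v
      have h2 := cubeWeight_anti (show (-(1 / 4) : ℝ) ≤ 0 by norm_num) v
      have h3 := cubeWeight_nonneg s v
      have h4 := cubeWeight_nonneg 0 v
      constructor <;> linarith
    · refine Eventually.of_forall fun v => ?_
      simpa using ((tendsto_cubeWeight v).sub_const (cubeWeight k 0 v)).abs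
  simpa using h

lemma measurableSet_simplex (m : ℕ) : MeasurableSet (simplex m) := by
  refine IsClosed.measurableSet ?_
  simp only [simplex, Monotone, ofPred_and, ofPred_forall]
  refine IsClosed.inter ?_ ?_
  · exact isClosed_iInter fun i => isClosed_iInter fun j => isClosed_iInter fun _ =>
      isClosed_le (continuous_apply _) (continuous_apply _)
  · exact isClosed_iInter fun i => (isClosed_le continuous_const (continuous_apply _)).inter
      (isClosed_le (continuous_apply _) continuous_const)

lemma measurableSet_region16 (p k : ℕ) (w : Fin (p - k) → ℝ) :
    MeasurableSet (region16 p k w) := by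
  refine IsClosed.measurableSet ?_
  simp only [region16, Monotone, ofPred_and, ofPred_forall]
  refine IsClosed.inter ?_ (IsClosed.inter ?_ ?_)
  · exact isClosed_iInter fun i => isClosed_iInter fun j => isClosed_iInter fun _ =>
      isClosed_le (continuous_apply _) (continuous_apply _)
  · exact isClosed_iInter fun i => isClosed_le (continuous_apply _) continuous_const
  · exact isClosed_iInter fun i => isClosed_iInter fun j =>
      isClosed_le continuous_const (continuous_apply _)

lemma measurable_splice {p k : ℕ} (hk : k ≤ p) (w : Fin (p - k) → ℝ) :
    Measurable (splice hk w) := by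
  refine measurable_pi_lambda _ fun i => ?_
  unfold splice
  split_ifs
  · exact measurable_const
  · exact measurable_pi_apply _

lemma splice_mem_simplex {p k : ℕ} (hk : k ≤ p) (hkp : k < p) {w : Fin (p - k) → ℝ}
    (hw : w ∈ simplex (p - k)) {v : Fin k → ℝ} (hv : v ∈ region16 p k w) :
    splice hk w v ∈ simplex p := by
  obtain ⟨hwm, hwb⟩ := hw
  obtain ⟨hvm, hv1, hwv⟩ := hv
  refine ⟨fun a b hab => ?_, fun i => ?_⟩
  · have hab' : (a : ℕ) ≤ b := hab
    unfold splice
    split_ifs with h1 h2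
    · exact hwm hab
    · exact hwv _ _
    · omega
    · exact hvm (Fin.mk_le_mk.2 (by omega))
  · unfold splice
    split_ifs with h1
    · exact hwb _
    · exact ⟨(hwb ⟨0, by omega⟩).1.trans (hwv _ _), hv1 _⟩

lemma aestronglyMeasurable_integrand16 {p q k : ℕ} (hk : k ≤ p) (hkp : k < p)
    {g : (Fin p → ℝ) → ℝ} (hgm : Measurable ((simplex p).domRestrict g)) (l : ℝ)
    {w : Fin (p - k) → ℝ} (hw : w ∈ simplex (p - k)) :
    AEStronglyMeasurable (integrand16 p q k hk g l w) (volume.restrict (region16 p k w)) := by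
  have hg : Measurable ((simplex p).indicator g) :=
    measurable_of_restrict_of_restrict_compl (measurableSet_simplex p)
      (by
        convert hgm using 1
        exact funext fun u => indicator_of_mem u.2 g)
      (by
        convert measurable_const (a := (0 : ℝ)) using 1
        exact funext fun u => indicator_of_notMem u.2 g)
  have hm : Measurable (integrand16 p q k hk ((simplex p).indicator g) l w) := by
    unfold integrand16
    refine Measurable.mul (by fun_prop) (Measurable.mul (by fun_prop) (Measurable.mul ?_
      (Measurable.mul (by fun_prop) (hg.comp (measurable_splice hk w)))))
    refine Finset.measurable_fun_prod _ fun j _ => Finset.measurable_fun_prod _ fun i _ => ?_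
    split_ifs <;> fun_prop
  refine hm.aestronglyMeasurable.congr
    ((ae_restrict_mem (measurableSet_region16 p k w)).mono fun v hv => ?_)
  simp only [integrand16, indicator_of_mem (splice_mem_simplex hk hkp hw hv)]

lemma ae_mem_Ioo_of_region16 {p k : ℕ} (hkp : k < p) {w : Fin (p - k) → ℝ}
    (hw : w ∈ simplex (p - k)) :
    ∀ᵐ v ∂volume.restrict (region16 p k w),
      v ∈ region16 p k w ∧ ∀ j, v j ∈ Ioo (0 : ℝ) 1 := by
  have hne (x : ℝ) : ∀ᵐ v : Fin k → ℝ, ∀ j, v j ≠ x :=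
    ae_all_iff.2 fun j => Measure.ae_eval_ne (μ := fun _ : Fin k => (volume : Measure ℝ)) j x
  filter_upwards [ae_restrict_mem (measurableSet_region16 p k w), ae_restrict_of_ae (hne 0),
    ae_restrict_of_ae (hne 1)] with v hv h0 h1
  exact ⟨hv, fun j => ⟨lt_of_le_of_ne ((hw.2 ⟨0, by omega⟩).1.trans (hv.2.2 _ j)) (h0 j).symm,
    lt_of_le_of_ne (hv.2.1 j) (h1 j)⟩⟩

lemma integrand16_eq_mul {p q k : ℕ} (hk : k ≤ p) (g : (Fin p → ℝ) → ℝ) (l l₀ : ℝ)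
    (w : Fin (p - k) → ℝ) {v : Fin k → ℝ} (hv : ∀ j, 0 < v j) :
    integrand16 p q k hk g l w v =
      (∏ j, v j ^ ((l - l₀) / 2)) * integrand16 p q k hk g l₀ w v := by
  have h : ∏ j, v j ^ ((l - 1) / 2) =
      (∏ j, v j ^ ((l - l₀) / 2)) * ∏ j, v j ^ ((l₀ - 1) / 2) := by
    rw [← Finset.prod_mul_distrib]
    refine Finset.prod_congr rfl fun j _ => ?_
    rw [← Real.rpow_add (hv j)]
    ring_nf
  rw [integrand16, h, mul_assoc, integrand16]

/-- At the pole the singularity of `v j ^ ((l - 1) / 2)` at zero is cancelled by the factors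
`v j - w i`. -/
lemma abs_integrand16_pole_le {p q k : ℕ} (hk : k ≤ p) (hkp : k < p) (hpq : p ≤ q)
    {g : (Fin p → ℝ) → ℝ} {C : ℝ} (hC : ∀ u ∈ simplex p, |g u| ≤ C)
    {w : Fin (p - k) → ℝ} (hw : w ∈ simplex (p - k)) {v : Fin k → ℝ}
    (hv : v ∈ region16 p k w) (hv01 : ∀ j, v j ∈ Ioo (0 : ℝ) 1) :
    |integrand16 p q k hk g ((k : ℝ) - p) w v| ≤
      C * ∏ j, (1 - v j) ^ (-(1 / 2) : ℝ) := by
  have hcast : ((p - k : ℕ) : ℝ) = (p : ℝ) - k := Nat.cast_sub hk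
  have hm : (1 : ℝ) ≤ (p : ℝ) - k := by
    rw [← hcast]; exact_mod_cast (by omega : 1 ≤ p - k)
  have hdiff0 : ∀ i j, 0 ≤ v j - w i := fun i j => sub_nonneg.2 (hv.2.2 i j)
  have hsing : |(∏ j, v j ^ (((k : ℝ) - p - 1) / 2)) * ∏ i, ∏ j, (v j - w i)| ≤ 1 := by
    rw [Finset.prod_comm, ← Finset.prod_mul_distrib, Finset.abs_prod]
    refine Finset.prod_le_one (fun _ _ => abs_nonneg _) fun j _ => ?_
    have hpos := (hv01 j).1
    rw [abs_of_nonneg (mul_nonneg (Real.rpow_nonneg hpos.le _)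
      (Finset.prod_nonneg fun i _ => hdiff0 i j))]
    calc v j ^ (((k : ℝ) - p - 1) / 2) * ∏ i, (v j - w i)
        ≤ v j ^ (((k : ℝ) - p - 1) / 2) * v j ^ ((p : ℝ) - k) := by
          refine mul_le_mul_of_nonneg_left ?_ (Real.rpow_nonneg hpos.le _)
          calc ∏ i, (v j - w i) ≤ ∏ _i : Fin (p - k), v j :=
                Finset.prod_le_prod (fun i _ => hdiff0 i j)
                  fun i _ => sub_le_self _ (hw.2 i).1
            _ = v j ^ ((p : ℝ) - k) := by
                rw [Finset.prod_const, Finset.card_univ, Fintype.card_fin, ← hcast,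
                  Real.rpow_natCast]
      _ = v j ^ (((p : ℝ) - k - 1) / 2) := by
          rw [← Real.rpow_add hpos]; ring_nf
      _ ≤ 1 := Real.rpow_le_one hpos.le (hv01 j).2.le (by linarith)
  have hvand : |∏ j : Fin k, ∏ i : Fin k, if i < j then v j - v i else 1| ≤ 1 := by
    simp only [Finset.abs_prod]
    refine Finset.prod_le_one (fun _ _ => Finset.prod_nonneg fun _ _ => abs_nonneg _) fun j _ =>
      Finset.prod_le_one (fun _ _ => abs_nonneg _) fun i _ => ?_
    split_ifs
    · have hi := hv01 i
      have hj := hv01 j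
      exact abs_le.2 ⟨by linarith [hi.2, hj.1], by linarith [hi.1, hj.2]⟩
    · simp
  have hone : |∏ j, (1 - v j) ^ (((q : ℝ) - p - 1) / 2)| ≤
      ∏ j, (1 - v j) ^ (-(1 / 2) : ℝ) := by
    have hpq' : (p : ℝ) ≤ q := by exact_mod_cast hpq
    have hnn : ∀ j, 0 ≤ (1 - v j) ^ (((q : ℝ) - p - 1) / 2) :=
      fun j => Real.rpow_nonneg (sub_nonneg.2 (hv01 j).2.le) _
    rw [abs_of_nonneg (Finset.prod_nonneg fun j _ => hnn j)]
    exact Finset.prod_le_prod (fun j _ => hnn j) fun j _ =>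
      Real.rpow_le_rpow_of_exponent_ge (sub_pos.2 (hv01 j).2)
        (by linarith [(hv01 j).1]) (by linarith)
  have hgC := hC _ (splice_mem_simplex hk hkp hw hv)
  have hnn : 0 ≤ ∏ j, (1 - v j) ^ (-(1 / 2) : ℝ) :=
    Finset.prod_nonneg fun j _ => Real.rpow_nonneg (sub_nonneg.2 (hv01 j).2.le) _
  rw [integrand16, ← mul_assoc, abs_mul, abs_mul _ (_ * g _), abs_mul _ (g _)]
  calc _ ≤ 1 * (1 * ((∏ j, (1 - v j) ^ (-(1 / 2) : ℝ)) * C)) := by gcongr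
    _ = _ := by ring

/-- Lemma 4.1 of the paper: the inner `k`-fold integral of the cosine-λ
transform on the real Grassmannian is finite near `λ = -p+k` and is uniformly continuous
there: `F(λ,·) → F(-p+k,·)` uniformly on the simplex as `λ → -p+k`. -/
theorem inner_integral_uniformly_continuous_at_higher_pole
    (p q k : ℕ) (hp : 2 ≤ p) (hpq : p ≤ q) (hk1 : 1 ≤ k) (hkp : k ≤ p - 1)
    (g : (Fin p → ℝ) → ℝ)
    (hgm : Measurable ((simplex p).restrict g))
    (hgb : ∃ C : ℝ, ∀ u ∈ simplex p, |g u| ≤ C)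
    (F : ℝ → (Fin (p - k) → ℝ) → ℝ)
    (hF : ∀ (l : ℝ) (w : Fin (p - k) → ℝ),
      F l w = ∫ v in region16 p k w, integrand16 p q k (by omega) g l w v) :
    (∀ l : ℝ, |l - ((k : ℝ) - (p : ℝ))| ≤ 1 / 2 → ∀ w ∈ simplex (p - k),
      IntegrableOn (integrand16 p q k (by omega) g l w) (region16 p k w)) ∧
    (∀ ε > (0:ℝ), ∃ δ > (0:ℝ), ∀ l : ℝ, |l - ((k : ℝ) - (p : ℝ))| < δ →
      ∀ w ∈ simplex (p - k), |F l w - F ((k : ℝ) - (p : ℝ)) w| < ε) := by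
  have hk : k ≤ p := by omega
  have hlt : k < p := by omega
  obtain ⟨C, hC⟩ := hgb
  set l₀ : ℝ := (k : ℝ) - p with hl₀
  have hint : ∀ l : ℝ, |l - l₀| ≤ 1 / 2 → ∀ w ∈ simplex (p - k),
      IntegrableOn (integrand16 p q k hk g l w) (region16 p k w) := by
    intro l hl w hw
    have hs : -1 < (l - l₀) / 2 := by linarith [(abs_le.1 hl).1]
    refine ((integrable_cubeWeight k hs).const_mul C).integrableOn.mono'
      (aestronglyMeasurable_integrand16 hk hlt hgm l hw)
      ((ae_mem_Ioo_of_region16 hlt hw).mono fun v hv => ?_)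
    have hnn : 0 ≤ ∏ j, v j ^ ((l - l₀) / 2) :=
      Finset.prod_nonneg fun j _ => Real.rpow_nonneg (hv.2 j).1.le _
    rw [integrand16_eq_mul hk g l l₀ w fun j => (hv.2 j).1, cubeWeight_eq_of_mem _ hv.2,
      norm_mul, Real.norm_of_nonneg hnn, mul_left_comm]
    exact mul_le_mul_of_nonneg_left (abs_integrand16_pole_le hk hlt hpq hC hw hv.1 hv.2) hnn
  refine ⟨hint, fun ε hε => ?_⟩
  have hC0 : 0 ≤ C := (abs_nonneg _).trans
    (hC 0 ⟨monotone_const, fun i => ⟨le_rfl, zero_le_one⟩⟩)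
  have htend : Tendsto
      (fun l => C * ∫ v, |cubeWeight k ((l - l₀) / 2) v - cubeWeight k 0 v|)
      (nhds l₀) (nhds 0) := by
    have hlin : Tendsto (fun l : ℝ => (l - l₀) / 2) (nhds l₀) (nhds 0) := by
      have hcont : Continuous fun l : ℝ => (l - l₀) / 2 := by fun_prop
      simpa using hcont.tendsto l₀
    simpa using ((tendsto_integral_abs_cubeWeight_sub k).comp hlin).const_mul C
  obtain ⟨δ, hδ, hδε⟩ := Metric.eventually_nhds_iff.1 (htend.eventually (gt_mem_nhds hε))
  refine ⟨min δ (1 / 2), lt_min hδ (by norm_num), fun l hl w hw => ?_⟩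
  have hl2 : |l - l₀| ≤ 1 / 2 := (hl.trans_le (min_le_right _ _)).le
  have hs : -1 < (l - l₀) / 2 := by linarith [(abs_le.1 hl2).1]
  have hwt : Integrable fun v => C * |cubeWeight k ((l - l₀) / 2) v - cubeWeight k 0 v| :=
    ((integrable_cubeWeight k hs).sub (integrable_cubeWeight k (by norm_num))).abs.const_mul C
  have hbound : ∀ᵐ v ∂volume.restrict (region16 p k w),
      ‖integrand16 p q k hk g l w v - integrand16 p q k hk g l₀ w v‖ ≤
        C * |cubeWeight k ((l - l₀) / 2) v - cubeWeight k 0 v| := by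
    refine (ae_mem_Ioo_of_region16 hlt hw).mono fun v hv => ?_
    have hnn : 0 ≤ ∏ j, (1 - v j) ^ (-(1 / 2) : ℝ) :=
      Finset.prod_nonneg fun j _ => Real.rpow_nonneg (sub_nonneg.2 (hv.2 j).2.le) _
    rw [integrand16_eq_mul hk g l l₀ w fun j => (hv.2 j).1, cubeWeight_eq_of_mem _ hv.2,
      cubeWeight_eq_of_mem _ hv.2, ← sub_one_mul, ← sub_mul, norm_mul, abs_mul,
      abs_of_nonneg hnn, mul_left_comm]
    simp only [Real.rpow_zero, Finset.prod_const_one]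
    exact mul_le_mul_of_nonneg_left (abs_integrand16_pole_le hk hlt hpq hC hw hv.1 hv.2)
      (abs_nonneg _)
  rw [hF, hF, ← integral_sub (hint l hl2 w hw) (hint l₀ (by norm_num) w hw), ← Real.norm_eq_abs]
  calc _ ≤ ∫ v in region16 p k w,
        C * |cubeWeight k ((l - l₀) / 2) v - cubeWeight k 0 v| :=
        norm_integral_le_of_norm_le hwt.integrableOn hbound
    _ ≤ ∫ v, C * |cubeWeight k ((l - l₀) / 2) v - cubeWeight k 0 v| :=
        setIntegral_le_integral hwt
          (Eventually.of_forall fun v => mul_nonneg hC0 (abs_nonneg _))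
    _ < ε := by
        rw [integral_const_mul]
        exact hδε (hl.trans_le (min_le_left _ _))
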